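/- arXiv:2004.15025 — 3 statements merged into one kernel-verified Lean document; each statement's English description precedes it below -/
import Mathlib

section
/- Let γ = (γ_Λ) be a monotone gradient specification, let Λ be a finite subset of ℤ^d, and let μ be a finite measure on (Ω², F²) with coordinate pair (φ₁, φ₂), writing f := φ₁ − φ₂, such that μ = μ(γ_Λ × γ_Λ). If μ-almost surely f ≥ a on ℤ^d∖Λ for some a ∈ ℝ, then −f ⪯ f − 2a under μ, i.e. μ(−f ∈ A) ≤ μ(f − 2a ∈ A) for every increasing event A. Similarly, if μ-almost surely f ≤ b on ℤ^d∖Λ for some b ∈ ℝ, then f ⪯ −f + 2b under μ. -/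
open MeasureTheory Filter Set
open scoped Classical ENNReal

noncomputable section

/-- The lattice `ℤ^d`. -/
abbrev V (d : ℕ) := Fin d → ℤ

/-- Height functions `ℤ^d → E`. -/
abbrev Config (d : ℕ) (E : Type*) := V d → E

/-- Nearest-neighbour graph distance `d₁` on `ℤ^d`. -/
def dist1 {d : ℕ} (x y : V d) : ℕ := ∑ i, (x i - y i).natAbs

/-- The tail σ-algebra `T_Λ = σ(φ(x) : x ∉ Λ)`. -/
def tailAlg (d : ℕ) (E : Type*) [MeasurableSpace E] (Λ : Set (V d)) :
    MeasurableSpace (Config d E) :=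
  ⨆ (x : V d) (_ : x ∉ Λ),
    MeasurableSpace.comap (fun φ : Config d E => φ x) inferInstance

/-- A specification: a consistent family of proper probability kernels from `(Ω, T_Λ)`
to `(Ω, F)`. -/
structure Spec (d : ℕ) (E : Type*) [MeasurableSpace E] where
  k : Finset (V d) → Config d E → Measure (Config d E)
  prob : ∀ Λ φ, k Λ φ Set.univ = 1
  kMeas : ∀ (Λ : Finset (V d)) (A : Set (Config d E)), MeasurableSet A →
    @Measurable _ _ (tailAlg d E (↑Λ : Set (V d))) _ fun φ => k Λ φ A
  proper : ∀ (Λ : Finset (V d)) (μ : Measure (Config d E)), μ Set.univ = 1 →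
    ∀ A : Set (Config d E), MeasurableSet[tailAlg d E (↑Λ : Set (V d))] A →
      (μ.bind (k Λ)) A = μ A
  consistent : ∀ Λ Δ : Finset (V d), Δ ⊆ Λ → ∀ φ, (k Λ φ).bind (k Δ) = k Λ φ

/-- A gradient specification. -/
def IsGradientSpec {d : ℕ} {E : Type*} [MeasurableSpace E] [AddCommGroup E]
    (γ : Spec d E) : Prop :=
  ∀ (Λ : Finset (V d)) (φ : Config d E) (a : E),
    (γ.k Λ φ).map (fun ψ y => ψ y + a) = γ.k Λ (fun y => φ y + a)

/-- Increasing events. -/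
def IncrEvent {d : ℕ} {α : Type*} [Preorder α] (A : Set (V d → α)) : Prop :=
  ∀ φ ψ : V d → α, φ ∈ A → φ ≤ ψ → ψ ∈ A

/-- Stochastic domination `μ ⪯ ν`. -/
def StochDom {d : ℕ} {E : Type*} [MeasurableSpace E] [Preorder E]
    (μ ν : Measure (Config d E)) : Prop :=
  ∀ A : Set (Config d E), MeasurableSet A → IncrEvent A → μ A ≤ ν A

/-- A monotone specification. -/
def IsMonotoneSpec {d : ℕ} {E : Type*} [MeasurableSpace E] [Preorder E]
    (γ : Spec d E) : Prop :=
  ∀ (Λ : Finset (V d)) (μ ν : Measure (Config d E)), IsProbabilityMeasure μ →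
    IsProbabilityMeasure ν → StochDom μ ν → StochDom (μ.bind (γ.k Λ)) (ν.bind (γ.k Λ))

/-- Statement 9 for a fixed height space `E` (realized in `ℝ` via `emb`). -/
def Stmt9 (E : Type*) [MeasurableSpace E] [AddCommGroup E] [LinearOrder E]
    (emb : E →+ ℝ) : Prop :=
  ∀ (d : ℕ), 1 ≤ d → ∀ γ : Spec d E, IsGradientSpec γ → IsMonotoneSpec γ →
  ∀ (Λ : Finset (V d)) (μ : Measure (Config d E × Config d E)), IsFiniteMeasure μ →
    μ = μ.bind (fun p => (γ.k Λ p.1).prod (γ.k Λ p.2)) →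
    (∀ a : ℝ,
      (∀ᵐ p ∂μ, ∀ x : V d, x ∉ Λ → a ≤ emb (p.1 x) - emb (p.2 x)) →
      ∀ A : Set (V d → ℝ), MeasurableSet A → IncrEvent A →
        μ {p | (fun x => -(emb (p.1 x) - emb (p.2 x))) ∈ A} ≤
          μ {p | (fun x => emb (p.1 x) - emb (p.2 x) - 2 * a) ∈ A}) ∧
    (∀ b : ℝ,
      (∀ᵐ p ∂μ, ∀ x : V d, x ∉ Λ → emb (p.1 x) - emb (p.2 x) ≤ b) →
      ∀ A : Set (V d → ℝ), MeasurableSet A → IncrEvent A →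
        μ {p | (fun x => emb (p.1 x) - emb (p.2 x)) ∈ A} ≤
          μ {p | (fun x => -(emb (p.1 x) - emb (p.2 x)) + 2 * b) ∈ A})

lemma tailAlg_le_comap_restrict {d : ℕ} {E : Type*} [MeasurableSpace E] (Λ : Set (V d)) :
    tailAlg d E Λ ≤ MeasurableSpace.comap
      (fun (φ : Config d E) (x : {x : V d // x ∉ Λ}) => φ x) MeasurableSpace.pi := by
  refine iSup₂_le fun x hx => ?_
  rintro _ ⟨s, hs, rfl⟩
  exact ⟨(fun ψ : {x : V d // x ∉ Λ} → E => ψ ⟨x, hx⟩) ⁻¹' s,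
    measurable_pi_apply (⟨x, hx⟩ : {x : V d // x ∉ Λ}) hs, rfl⟩

lemma tailAlg_le_pi {d : ℕ} {E : Type*} [MeasurableSpace E] (Λ : Set (V d)) :
    tailAlg d E Λ ≤ MeasurableSpace.pi :=
  iSup₂_le fun x _ => (measurable_pi_apply x).comap_le

namespace Spec

variable {d : ℕ} {E : Type*} [MeasurableSpace E] (γ : Spec d E) (Λ : Finset (V d))

lemma measurable_k : Measurable (γ.k Λ) :=
  Measure.measurable_of_measurable_coe _ fun A hA =>
    (γ.kMeas Λ A hA).mono (tailAlg_le_pi _) le_rfl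

lemma isProbabilityMeasure_k (φ : Config d E) : IsProbabilityMeasure (γ.k Λ φ) :=
  ⟨γ.prob Λ φ⟩

lemma k_congr {φ ψ : Config d E} (h : ∀ x ∉ Λ, φ x = ψ x) : γ.k Λ φ = γ.k Λ ψ := by
  ext A hA
  obtain ⟨s, -, hs⟩ := tailAlg_le_comap_restrict _ _
    (γ.kMeas Λ A hA (measurableSet_singleton (γ.k Λ ψ A)))
  have hψ : ψ ∈ (fun φ => γ.k Λ φ A) ⁻¹' {γ.k Λ ψ A} := rfl
  have hr : (fun x : {x : V d // x ∉ (Λ : Set (V d))} => φ x.1) = fun x => ψ x.1 :=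
    funext fun x => h x (by simpa using x.2)
  have hφ : φ ∈ (fun φ => γ.k Λ φ A) ⁻¹' {γ.k Λ ψ A} := by
    rw [← hs] at hψ ⊢
    simpa only [Set.mem_preimage, hr] using hψ
  exact hφ

lemma measurable_k_prod :
    Measurable fun p : Config d E × Config d E => (γ.k Λ p.1).prod (γ.k Λ p.2) := by
  let κ : ProbabilityTheory.Kernel (Config d E) (Config d E) := ⟨γ.k Λ, γ.measurable_k Λ⟩
  have : ProbabilityTheory.IsMarkovKernel κ := ⟨γ.isProbabilityMeasure_k Λ⟩
  convert (ProbabilityTheory.Kernel.parallelComp κ κ).measurable using 2 with p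
  rw [ProbabilityTheory.Kernel.parallelComp_apply]
  rfl

/-- The kernels of a monotone specification are increasing in the boundary condition. -/
lemma stochDom_k [Preorder E] (hmono : IsMonotoneSpec γ) {φ ψ : Config d E}
    (h : ∀ x ∉ Λ, φ x ≤ ψ x) : StochDom (γ.k Λ φ) (γ.k Λ ψ) := by
  let φ' : Config d E := fun x => if x ∈ Λ then ψ x else φ x
  have hle : φ' ≤ ψ := fun x => by
    by_cases hx : x ∈ Λ
    · simp [φ', hx]
    · simpa [φ', hx] using h x hx
  have hdirac : StochDom (Measure.dirac φ') (Measure.dirac ψ) := fun A hA hincr => by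
    rw [Measure.dirac_apply' _ hA, Measure.dirac_apply' _ hA]
    by_cases hφ : φ' ∈ A
    · simp [hφ, hincr _ _ hφ hle]
    · simp [hφ]
  have hbind := hmono Λ _ _ inferInstance inferInstance hdirac
  rw [Measure.dirac_bind (γ.measurable_k Λ), Measure.dirac_bind (γ.measurable_k Λ)] at hbind
  rwa [γ.k_congr Λ (φ := φ) (ψ := φ') fun x hx => by simp [φ', hx]]

end Spec

/-- If `P ⪯ Q` then exchanging the factors of `P × Q` increases the measure of every event that
is increasing in the first and decreasing in the second coordinate. -/
lemma StochDom.prod_le_prod_swap {d : ℕ} {E : Type*} [MeasurableSpace E] [Preorder E]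
    {P Q : Measure (Config d E)} [IsProbabilityMeasure P] [IsProbabilityMeasure Q]
    (h : StochDom P Q) {S : Set (Config d E × Config d E)} (hS : MeasurableSet S)
    (hmono : ∀ ⦃x x' y y' : Config d E⦄, x ≤ x' → y' ≤ y → (x, y) ∈ S → (x', y') ∈ S) :
    P.prod Q S ≤ Q.prod P S := by
  have hfst : P.prod Q S ≤ Q.prod Q S := by
    rw [Measure.prod_apply_symm hS, Measure.prod_apply_symm hS]
    exact lintegral_mono fun y => h _ (measurable_prodMk_right hS)
      fun x x' hx hxx' => hmono hxx' le_rfl hx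
  have hsnd : Q.prod Q S ≤ Q.prod P S := by
    rw [Measure.prod_apply hS, Measure.prod_apply hS]
    refine lintegral_mono fun x => ?_
    have hT : MeasurableSet (Prod.mk x ⁻¹' S) := measurable_prodMk_left hS
    have hc := h _ hT.compl fun y y' hy hyy' hy' => hy (hmono le_rfl hyy' hy')
    rw [prob_compl_eq_one_sub hT, prob_compl_eq_one_sub hT] at hc
    exact (ENNReal.sub_le_sub_iff_left prob_le_one ENNReal.one_ne_top).1 hc
  exact hfst.trans hsnd

section Reflection

variable {d : ℕ} {E : Type*} [MeasurableSpace E] [AddCommGroup E] {emb : E →+ ℝ}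

lemma measurableSet_mul_emb_sub_add (hmeas : Measurable emb) (s t : ℝ) {A : Set (V d → ℝ)}
    (hA : MeasurableSet A) :
    MeasurableSet {p : Config d E × Config d E |
      (fun x => s * (emb (p.1 x) - emb (p.2 x)) + t) ∈ A} :=
  measurableSet_preimage (f := fun (p : Config d E × Config d E) (x : V d) =>
    s * (emb (p.1 x) - emb (p.2 x)) + t) (by fun_prop) hA

variable [LinearOrder E]

lemma StochDom.prod_reflection (hmeas : Measurable emb) (hemb : Monotone emb)
    {P Q : Measure (Config d E)} [IsProbabilityMeasure P] [IsProbabilityMeasure Q]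
    (h : StochDom P Q) (t : ℝ) {A : Set (V d → ℝ)} (hA : MeasurableSet A) (hincr : IncrEvent A) :
    P.prod Q {p | (fun x => emb (p.1 x) - emb (p.2 x) + t) ∈ A} ≤
      P.prod Q {p | (fun x => -(emb (p.1 x) - emb (p.2 x)) + t) ∈ A} := by
  have hS : MeasurableSet {p : Config d E × Config d E |
      (fun x => emb (p.1 x) - emb (p.2 x) + t) ∈ A} := by
    simpa only [one_mul] using measurableSet_mul_emb_sub_add hmeas 1 t hA
  refine (h.prod_le_prod_swap hS fun x x' y y' hx hy hxy => hincr _ _ hxy fun z => ?_).trans_eq ?_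
  · exact add_le_add_left (sub_le_sub (hemb (hx z)) (hemb (hy z))) t
  · rw [← Measure.prod_swap, Measure.map_apply measurable_swap hS]
    congr 1
    ext p
    simp

variable [MeasurableAdd E] {γ : Spec d E}

lemma Spec.prod_k_reflection (hmeas : Measurable emb) (hemb : Monotone emb)
    (hgrad : IsGradientSpec γ) (hmono : IsMonotoneSpec γ) (Λ : Finset (V d)) {φ ψ : Config d E}
    {c : E} (h : ∀ x ∉ Λ, φ x ≤ ψ x + c) {A : Set (V d → ℝ)} (hA : MeasurableSet A)
    (hincr : IncrEvent A) :
    (γ.k Λ φ).prod (γ.k Λ ψ) {p | (fun x => emb (p.1 x) - emb (p.2 x)) ∈ A} ≤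
      (γ.k Λ φ).prod (γ.k Λ ψ)
        {p | (fun x => -(emb (p.1 x) - emb (p.2 x)) + 2 * emb c) ∈ A} := by
  have := γ.isProbabilityMeasure_k Λ
  have hshift : Measurable fun (η : Config d E) (y : V d) => η y + c :=
    measurable_pi_lambda _ fun y => (measurable_add_const c).comp (measurable_pi_apply y)
  have hprod : (γ.k Λ φ).prod (γ.k Λ fun y => ψ y + c) =
      ((γ.k Λ φ).prod (γ.k Λ ψ)).map (Prod.map id fun η y => η y + c) := by
    rw [← hgrad, ← Measure.map_prod_map _ _ measurable_id hshift, Measure.map_id]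
  have key := (γ.stochDom_k Λ hmono h).prod_reflection hmeas hemb (emb c) hA hincr
  have hS₁ := measurableSet_mul_emb_sub_add (d := d) hmeas 1 (emb c) hA
  have hS₂ := measurableSet_mul_emb_sub_add (d := d) hmeas (-1) (emb c) hA
  simp only [one_mul, neg_one_mul] at hS₁ hS₂
  rw [hprod, Measure.map_apply (measurable_id.prodMap hshift) hS₁,
    Measure.map_apply (measurable_id.prodMap hshift) hS₂] at key
  convert key using 2 <;>
  · ext p
    simp only [Set.mem_ofPred_eq, Set.mem_preimage, Prod.map_fst, Prod.map_snd, id, map_add]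
    congr! 2 with x
    ring

/-- The reflection principle for heights along which every real number can be rounded up. -/
lemma stmt9_of_exists_ceil [IsOrderedAddMonoid E] (hmeas : Measurable emb) (hemb : Monotone emb)
    (hceil : ∀ a : ℝ, ∃ c : E, a ≤ emb c ∧ ∀ x, a ≤ emb x → c ≤ x) : Stmt9 E emb := by
  intro d _ γ hgrad hmono Λ μ _ hμ
  have hk := γ.measurable_k_prod Λ
  have hle {S T : Set (Config d E × Config d E)} (hS : MeasurableSet S) (hT : MeasurableSet T)
      (h : ∀ᵐ p ∂μ, (γ.k Λ p.1).prod (γ.k Λ p.2) S ≤ (γ.k Λ p.1).prod (γ.k Λ p.2) T) :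
      μ S ≤ μ T := by
    rw [hμ, Measure.bind_apply hS hk.aemeasurable, Measure.bind_apply hT hk.aemeasurable]
    exact lintegral_mono_ae h
  have := γ.isProbabilityMeasure_k Λ
  refine ⟨fun a ha A hA hincr => ?_, fun b hb A hA hincr => ?_⟩
  · obtain ⟨c, hac, hc⟩ := hceil a
    have hS := measurableSet_mul_emb_sub_add (d := d) hmeas (-1) 0 hA
    have hT := measurableSet_mul_emb_sub_add (d := d) hmeas 1 (-(2 * a)) hA
    simp only [one_mul, neg_one_mul, add_zero, ← sub_eq_add_neg] at hS hT
    refine hle hS hT ?_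
    filter_upwards [ha] with p hp
    have key := Spec.prod_k_reflection hmeas hemb hgrad hmono Λ (φ := p.2) (ψ := p.1) (c := -c)
      (fun x hx => by
        have := hc (p.1 x - p.2 x) (by simpa using hp x hx)
        rw [← sub_eq_add_neg]
        exact le_sub_comm.1 this) hA hincr
    rw [← Measure.prod_swap] at key
    have hS' := measurableSet_mul_emb_sub_add (d := d) hmeas 1 0 hA
    have hT' := measurableSet_mul_emb_sub_add (d := d) hmeas (-1) (2 * emb (-c)) hA
    simp only [one_mul, neg_one_mul, add_zero] at hS' hT'
    rw [Measure.map_apply measurable_swap hS', Measure.map_apply measurable_swap hT'] at key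
    refine (le_of_eq ?_).trans (key.trans (measure_mono fun q hq => hincr _ _ hq fun x => ?_))
    · congr 1
      ext q
      simp
    · simp only [Prod.fst_swap, Prod.snd_swap, map_neg]
      linarith
  · obtain ⟨c, hac, hc⟩ := hceil (-b)
    have hS := measurableSet_mul_emb_sub_add (d := d) hmeas 1 0 hA
    have hT := measurableSet_mul_emb_sub_add (d := d) hmeas (-1) (2 * b) hA
    simp only [one_mul, neg_one_mul, add_zero] at hS hT
    refine hle hS hT ?_
    filter_upwards [hb] with p hp
    have key := Spec.prod_k_reflection hmeas hemb hgrad hmono Λ (φ := p.1) (ψ := p.2) (c := -c)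
      (fun x hx => by
        have := hc (p.2 x - p.1 x) (by
          rw [map_sub]
          linarith [hp x hx])
        rw [← sub_eq_add_neg]
        exact le_sub_comm.1 this) hA hincr
    refine key.trans (measure_mono fun q hq => hincr _ _ hq fun x => ?_)
    simp only [map_neg]
    linarith

end Reflection

/-- (the reflection principle), for `E = ℤ` and `E = ℝ`. -/
theorem statement9 : Stmt9 ℤ (Int.castAddHom ℝ) ∧ Stmt9 ℝ (AddMonoidHom.id ℝ) := by
  refine ⟨stmt9_of_exists_ceil measurable_from_top (fun x y h => by simpa using h) fun a =>
    ⟨⌈a⌉, by simpa using Int.le_ceil a, fun x hx => Int.ceil_le.2 (by simpa using hx)⟩,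
    stmt9_of_exists_ceil measurable_id monotone_id fun a => ⟨a, le_rfl, fun x hx => hx⟩⟩

end
end

section
/- Let f: ℤ^d → ℝ be 2K-Lipschitz, let Λ ⊆ ℤ^d be finite and connected, and let a, b ∈ ℝ with b − a ≥ 4K. Suppose A ⊆ ℤ^d is such that Λ is contained in a finite connected component A^Λ of ℤ^d∖A. If f < a on A and f ≥ b on Λ, then A^Λ contains a climbing a,b-moat of (f, Λ); if f ≥ b on A and f < a on Λ, then A^Λ contains a descending a,b-moat of (f, Λ). -/
open Set

noncomputable section

/-- Nearest-neighbour adjacency on `ℤ^d`. -/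
def adj1 {d : ℕ} (x y : V d) : Prop := dist1 x y = 1

/-- The connected component of `x` inside a set `s` (nearest-neighbour connectivity). -/
def compIn {d : ℕ} (s : Set (V d)) (x : V d) : Set (V d) :=
  {y | Relation.ReflTransGen (fun a b => a ∈ s ∧ b ∈ s ∧ adj1 a b) x y}

/-- `C` is a connected component of `s`. -/
def IsCompOf {d : ℕ} (C s : Set (V d)) : Prop := ∃ x ∈ s, C = compIn s x

/-- The set `s` is connected. -/
def ConnSet {d : ℕ} (s : Set (V d)) : Prop := ∀ x ∈ s, ∀ y ∈ s, y ∈ compIn s x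

/-- The inside `M^Λ` of `M`: the connected component of the complement of `M`
containing `Λ`. -/
def inside {d : ℕ} (Λ M : Set (V d)) : Set (V d) := ⋃ x ∈ Λ, compIn Mᶜ x

/-- The outside `M^∞` of `M`: the unbounded connected component of the complement. -/
def outsideM {d : ℕ} (M : Set (V d)) : Set (V d) :=
  {y | y ∉ M ∧ ¬ (compIn Mᶜ y).Finite}

/-- The inside boundary `∂_Λ M`. -/
def inBnd {d : ℕ} (Λ M : Set (V d)) : Set (V d) :=
  {y | y ∈ inside Λ M ∧ ∃ m ∈ M, adj1 y m}

/-- The outside boundary `∂_∞ M`. -/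
def outBnd {d : ℕ} (M : Set (V d)) : Set (V d) :=
  {y | y ∈ outsideM M ∧ ∃ m ∈ M, adj1 y m}

/-- `M` is an `a,b`-moat of `(f, Λ)`. -/
structure IsMoat {d : ℕ} (f : V d → ℝ) (Λ : Set (V d)) (a b : ℝ) (M : Set (V d)) : Prop where
  isComp : IsCompOf M {x | a ≤ f x ∧ f x < b}
  finite : M.Finite
  surrounds : ∃ C : Set (V d), IsCompOf C Mᶜ ∧ C.Finite ∧ Λ ⊆ C

/-- A climbing moat. -/
def Climbing {d : ℕ} (f : V d → ℝ) (Λ : Set (V d)) (a b : ℝ) (M : Set (V d)) : Prop :=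
  IsMoat f Λ a b M ∧ (∀ y ∈ outBnd M, f y < a) ∧ (∀ y ∈ inBnd Λ M, b ≤ f y)

/-- A descending moat. -/
def Descending {d : ℕ} (f : V d → ℝ) (Λ : Set (V d)) (a b : ℝ) (M : Set (V d)) : Prop :=
  IsMoat f Λ a b M ∧ (∀ y ∈ outBnd M, b ≤ f y) ∧ (∀ y ∈ inBnd Λ M, f y < a)

/-- A nested sequence of `a,b`-moats of `(f, Λ)`: each moat surrounds the next one,
alternately climbing and descending, the first one climbing. -/
def NestedMoats {d : ℕ} (f : V d → ℝ) (Λ : Set (V d)) (a b : ℝ) {n : ℕ}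
    (M : Fin n → Set (V d)) : Prop :=
  (∀ i : Fin n, if (i : ℕ) % 2 = 0 then Climbing f Λ a b (M i)
    else Descending f Λ a b (M i)) ∧
  ∀ (i : ℕ) (h : i + 1 < n), M ⟨i + 1, h⟩ ⊆ inside Λ (M ⟨i, Nat.lt_of_succ_lt h⟩)

section Adjacency

variable {d : ℕ} {x y z : V d}

lemma dist1_comm (x y : V d) : dist1 x y = dist1 y x :=
  Finset.sum_congr rfl fun i _ => by rw [← Int.natAbs_neg, neg_sub]

lemma dist1_triangle (x y z : V d) : dist1 x z ≤ dist1 x y + dist1 y z := by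
  unfold dist1
  rw [← Finset.sum_add_distrib]
  exact Finset.sum_le_sum fun i _ => by omega

lemma adj1.symm (h : adj1 x y) : adj1 y x := by rwa [adj1, dist1_comm]

lemma adj1_add_single (x : V d) (i : Fin d) : adj1 x (x + Pi.single i 1) := by
  unfold adj1 dist1
  rw [Finset.sum_eq_single i] <;> simp +contextual

lemma adj1.exists_single (h : adj1 x y) :
    ∃ i, y = x + Pi.single i 1 ∨ x = y + Pi.single i 1 := by
  unfold adj1 dist1 at h
  obtain ⟨i, hi⟩ : ∃ i, (x i - y i).natAbs ≠ 0 := by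
    by_contra! hc
    simp [hc] at h
  have hsum := Finset.add_sum_erase Finset.univ (fun i => (x i - y i).natAbs) (Finset.mem_univ i)
  have hrest : ∑ j ∈ Finset.univ.erase i, (x j - y j).natAbs = 0 := by
    omega
  have hoff : ∀ j, j ≠ i → x j = y j := fun j hj => by
    have := Finset.sum_eq_zero_iff.1 hrest j (by simp [hj])
    omega
  have hon : (x i - y i).natAbs = 1 := by omega
  refine ⟨i, ?_⟩
  rcases Int.natAbs_eq_iff.1 hon with h1 | h1
  · right; ext j
    by_cases hj : j = i
    · subst hj; simp; omega
    · simp [hj, hoff j hj]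
  · left; ext j
    by_cases hj : j = i
    · subst hj; simp; push_cast at h1; omega
    · simp [hj, hoff j hj]

end Adjacency

section Components

variable {d : ℕ} {s t : Set (V d)} {x y z : V d}

lemma mem_compIn_self (s : Set (V d)) (x : V d) : x ∈ compIn s x := Relation.ReflTransGen.refl

lemma compIn_trans (h₁ : y ∈ compIn s x) (h₂ : z ∈ compIn s y) : z ∈ compIn s x :=
  Relation.ReflTransGen.trans h₁ h₂

lemma mem_compIn_of_adj (hx : x ∈ s) (hy : y ∈ s) (h : adj1 x y) : y ∈ compIn s x :=
  Relation.ReflTransGen.single ⟨hx, hy, h⟩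

lemma compIn_symm (h : y ∈ compIn s x) : x ∈ compIn s y :=
  have : Std.Symm (fun a b => a ∈ s ∧ b ∈ s ∧ adj1 a b) :=
    ⟨fun _ _ ⟨h₁, h₂, h₃⟩ => ⟨h₂, h₁, h₃.symm⟩⟩
  Relation.ReflTransGen.stdSymm.symm _ _ h

lemma compIn_mono (h : s ⊆ t) (x : V d) : compIn s x ⊆ compIn t x := fun _ hy =>
  Relation.ReflTransGen.mono (fun _ _ ⟨h₁, h₂, h₃⟩ => ⟨h h₁, h h₂, h₃⟩) _ _ hy

lemma compIn_subset (hx : x ∈ s) : compIn s x ⊆ s := fun y hy => by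
  induction hy with
  | refl => exact hx
  | tail _ h _ => exact h.2.1

lemma compIn_eq (h : y ∈ compIn s x) : compIn s y = compIn s x :=
  Set.ext fun _ => ⟨compIn_trans h, compIn_trans (compIn_symm h)⟩

lemma IsCompOf.eq_compIn {C : Set (V d)} (hC : IsCompOf C s) (hy : y ∈ C) : C = compIn s y := by
  obtain ⟨x, -, rfl⟩ := hC
  exact (compIn_eq hy).symm

/-- A path in `s` from inside `D` to outside `D` crosses the edge boundary of `D`. -/
lemma exists_exit {D : Set (V d)} (h : y ∈ compIn s x) (hx : x ∈ D) (hy : y ∉ D) :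
    ∃ u v, u ∈ D ∧ v ∉ D ∧ u ∈ s ∧ v ∈ s ∧ adj1 u v := by
  induction h with
  | refl => exact absurd hx hy
  | @tail u v _ huv ih =>
    by_cases hu : u ∈ D
    · exact ⟨u, v, hu, hy, huv⟩
    · exact ih hu

lemma mem_compIn_compIn (h : y ∈ compIn s x) : y ∈ compIn (compIn s x) x := by
  induction h with
  | refl => exact mem_compIn_self _ _
  | tail h huv ih => exact ih.tail ⟨h, h.tail huv, huv.2.2⟩

lemma connSet_compIn (s : Set (V d)) (x : V d) : ConnSet (compIn s x) := fun _ hy _ hz =>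
  compIn_trans (compIn_symm (mem_compIn_compIn hy)) (mem_compIn_compIn hz)

lemma notMem_of_adj_compIn {u v : V d} (hx : x ∈ s) (hu : u ∈ compIn s x)
    (hv : v ∉ compIn s x) (h : adj1 u v) : v ∉ s := fun hvs =>
  hv (compIn_trans hu (mem_compIn_of_adj (compIn_subset hx hu) hvs h))

lemma update_mem_compIn (i : Fin d) (h : ∀ t, Function.update x i t ∈ s) (t : ℤ) :
    Function.update x i t ∈ compIn s x := by
  have step (t : ℤ) : Function.update x i (t + 1) ∈ compIn s (Function.update x i t) := by
    refine mem_compIn_of_adj (h _) (h _) ?_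
    convert adj1_add_single (Function.update x i t) i using 1
    ext j
    by_cases hj : j = i
    · subst hj; simp
    · simp [hj]
  have main (n : ℤ) : Function.update x i (x i + n) ∈ compIn s x := by
    induction n using Int.induction_on with
    | zero => simpa using mem_compIn_self s x
    | succ n ih => rw [← add_assoc]; exact compIn_trans ih (step _)
    | pred n ih =>
      refine compIn_trans ih (compIn_symm ?_)
      convert step (x i + (-n - 1)) using 2
      ring
  simpa using main (t - x i)

/-- The complement of a box is connected in dimension at least two. -/
lemma corner_mem_compIn (hd : 2 ≤ d) {N : ℤ} (hs : ∀ x : V d, (∃ i, N < |x i|) → x ∈ s)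
    (hx : ∃ i, N < |x i|) : (fun _ => |N| + 1 : V d) ∈ compIn s x := by
  obtain ⟨i, hi⟩ := hx
  set q : V d := fun _ => |N| + 1
  have hq (j) : N < |q j| := by
    have h₁ := le_abs_self N
    have h₂ := le_abs_self (|N| + 1)
    change N < |(|N| + 1)|
    omega
  have key (t : Finset (Fin d)) (ht : i ∉ t) : t.piecewise q x ∈ compIn s x := by
    induction t using Finset.induction_on with
    | empty => simpa using mem_compIn_self s x
    | insert j t hj ih =>
      rw [Finset.mem_insert, not_or] at ht
      rw [Finset.piecewise_insert]
      refine compIn_trans (ih ht.2) (update_mem_compIn j (fun r => hs _ ⟨i, ?_⟩) _)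
      simpa [Function.update_of_ne ht.1, ht.2] using hi
  have hmove := key (Finset.univ.erase i) (by simp)
  obtain ⟨j, hj⟩ : ∃ j : Fin d, j ≠ i := by
    have : Nontrivial (Fin d) := Fin.nontrivial_iff_two_le.2 hd
    exact exists_ne i
  have hlast := update_mem_compIn (x := (Finset.univ.erase i).piecewise q x) (s := s) i
    (fun r => hs _ ⟨j, by simpa [Function.update_of_ne hj, hj] using hq j⟩) (q i)
  rw [← Finset.piecewise_insert, Finset.insert_erase (Finset.mem_univ i)] at hlast
  simpa using compIn_trans hmove hlast

lemma mem_compIn_univ (hd : 2 ≤ d) (x y : V d) : y ∈ compIn univ x := by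
  have h (z : V d) := corner_mem_compIn (s := univ) (x := z) hd (N := -1) (fun _ _ => mem_univ _)
    ⟨⟨0, by omega⟩, lt_of_lt_of_le (by norm_num) (abs_nonneg _)⟩
  exact compIn_trans (h x) (compIn_symm (h y))

lemma finite_box (d : ℕ) (N : ℤ) : {x : V d | ¬ ∃ i, N < |x i|}.Finite := by
  refine (Set.finite_Icc (fun _ => -N : V d) (fun _ => N)).subset fun x hx => ?_
  simp only [not_exists, not_lt, mem_ofPred_eq, abs_le] at hx
  exact ⟨fun i => (hx i).1, fun i => (hx i).2⟩

lemma Set.Finite.exists_box (hs : s.Finite) : ∃ N : ℤ, ∀ x ∈ s, ¬ ∃ i, N < |x i| := by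
  induction s, hs using Set.Finite.induction_on with
  | empty => exact ⟨0, by simp⟩
  | @insert a s _ _ ih =>
    obtain ⟨N, hN⟩ := ih
    refine ⟨max N (∑ i, |a i|), ?_⟩
    rintro x (rfl | hx) ⟨i, hi⟩
    · have := Finset.single_le_sum (f := fun i => |x i|) (fun i _ => abs_nonneg _)
        (Finset.mem_univ i)
      exact absurd (lt_of_le_of_lt (le_max_right _ _) hi) (not_lt.2 this)
    · exact hN x hx ⟨i, lt_of_le_of_lt (le_max_left _ _) hi⟩

/-- The complement of a component of the complement of a connected set is connected. -/
lemma connSet_compl_compIn (hd : 2 ≤ d) {G : Set (V d)} (hG : ConnSet G) (hne : G.Nonempty)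
    (hx : x ∉ G) : ConnSet (compIn Gᶜ x)ᶜ := by
  obtain ⟨g, hg⟩ := hne
  have hsub : G ⊆ (compIn Gᶜ x)ᶜ := fun u hu hu' => compIn_subset (s := Gᶜ) hx hu' hu
  have key (y : V d) (hy : y ∈ (compIn Gᶜ x)ᶜ) : g ∈ compIn (compIn Gᶜ x)ᶜ y := by
    have hwalk := mem_compIn_univ hd y g
    induction hwalk using Relation.ReflTransGen.head_induction_on with
    | refl => exact mem_compIn_self _ _
    | @head u v huv _ ih =>
      by_cases hu : u ∈ G
      · exact compIn_mono hsub _ (hG u hu g hg)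
      · have hv : v ∈ (compIn Gᶜ x)ᶜ := fun hv =>
          notMem_of_adj_compIn hx hv hy huv.2.2.symm hu
        exact compIn_trans (mem_compIn_of_adj hy hv huv.2.2) (ih hv)
  exact fun y hy z hz => compIn_trans (key y hy) (compIn_symm (key z hz))

end Components

section EdgeBoundary

variable {d : ℕ}

lemma exists_int_antideriv (u : ℤ → ℤ) : ∃ F : ℤ → ℤ, ∀ n, F (n + 1) - F n = u n := by
  refine ⟨fun n => ∑ k ∈ Finset.range n.toNat, u k -
    ∑ k ∈ Finset.range (-n).toNat, u (-(k + 1)), fun n => ?_⟩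
  rcases le_or_gt 0 n with hn | hn
  · lift n to ℕ using hn
    have h₁ : ((n : ℤ) + 1).toNat = n + 1 := by omega
    have h₂ : (-((n : ℤ) + 1)).toNat = 0 := by omega
    have h₃ : (-(n : ℤ)).toNat = 0 := by omega
    simp only [h₁, h₂, h₃, Int.toNat_natCast, Finset.sum_range_succ, Finset.sum_range_zero]
    ring
  · obtain ⟨m, rfl⟩ : ∃ m : ℕ, n = -(m + 1) := ⟨(-n - 1).toNat, by omega⟩
    have h₁ : (-(-((m : ℤ) + 1))).toNat = m + 1 := by omega
    have h₂ : (-(-((m : ℤ) + 1) + 1)).toNat = m := by omega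
    have h₃ : (-((m : ℤ) + 1)).toNat = 0 := by omega
    have h₄ : (-((m : ℤ) + 1) + 1).toNat = 0 := by omega
    simp only [h₁, h₂, h₃, h₄, Finset.sum_range_succ, Finset.sum_range_zero]
    ring

/-- Discrete Poincaré lemma: closed `1`-cochains on `ℤ^d` are exact. -/
lemma exists_potential (ω : V d → Fin d → ℤ)
    (hω : ∀ x i j, ω x i + ω (x + Pi.single i 1) j = ω x j + ω (x + Pi.single j 1) i) :
    ∃ h : V d → ℤ, ∀ x i, h (x + Pi.single i 1) - h x = ω x i := by
  suffices H : ∀ t : Finset (Fin d), ∃ h : V d → ℤ, ∀ x, ∀ i ∈ t,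
      h (x + Pi.single i 1) - h x = ω x i by
    obtain ⟨h, hh⟩ := H Finset.univ
    exact ⟨h, fun x i => hh x i (Finset.mem_univ i)⟩
  intro t
  induction t using Finset.induction_on with
  | empty => exact ⟨0, by simp⟩
  | insert j t hj ih =>
    obtain ⟨h, hh⟩ := ih
    choose F hF using exists_int_antideriv
    set η : V d → ℤ := fun x => ω x j - (h (x + Pi.single j 1) - h x) with hη
    have hinv (x) (i) (hi : i ∈ t) : η (x + Pi.single i 1) = η x := by
      have h₁ := hh x i hi
      have h₂ := hh (x + Pi.single j 1) i hi
      have h₃ := hω x i j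
      rw [add_right_comm] at h₂
      simp only [hη]
      linarith
    refine ⟨fun x => h x + F (fun t => η (Function.update x j t)) (x j), fun x i hi => ?_⟩
    rcases eq_or_ne i j with rfl | hij
    · have hup (t : ℤ) : Function.update (x + Pi.single i 1) i t = Function.update x i t := by
        ext k
        by_cases hk : k = i
        · subst hk; simp
        · simp [hk]
      have := hF (fun t => η (Function.update x i t)) (x i)
      simp only [Function.update_eq_self] at this
      simp only [hup, Pi.add_apply, Pi.single_eq_same]
      simp only [hη] at this ⊢
      linarith
    · have hit : i ∈ t := (Finset.mem_insert.1 hi).resolve_left hij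
      have hup (t : ℤ) : Function.update (x + Pi.single i 1) j t =
          Function.update x j t + Pi.single i 1 := by
        ext k
        by_cases hk : k = j
        · subst hk; simp [hij.symm]
        · simp [hk]
      have := hh x i hit
      simp only [hup, hinv _ i hit, Pi.add_apply, Pi.single_eq_of_ne hij.symm, add_zero]
      linarith

/-- If `D` and its complement are connected, then the edge boundary of `D` is connected through
plaquettes: a property of inner boundary vertices that propagates across plaquettes holds
everywhere as soon as it holds somewhere. -/
lemma boundary_induction {D : Set (V d)} (hD : ConnSet D) (hDc : ConnSet Dᶜ) (P : V d → Prop)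
    (hP : ∀ u v u' v', u ∈ D → v ∉ D → adj1 u v → u' ∈ D → v' ∉ D → adj1 u' v' →
      (adj1 u u' ∨ adj1 v u') → P u → P u')
    {u v u' v' : V d} (hu : u ∈ D) (hv : v ∉ D) (huv : adj1 u v)
    (hu' : u' ∈ D) (hv' : v' ∉ D) (huv' : adj1 u' v') (hPu : P u) : P u' := by
  classical
  obtain ⟨p, hp_def⟩ : ∃ p : V d → ℤ, p = fun x => if P x then 1 else 0 := ⟨_, rfl⟩
  let e : V d → V d → ℤ := fun x y =>
    if x ∈ D then (if y ∈ D then 0 else - p x) else (if y ∈ D then p y else 0)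
  have hanti (x y) : e y x = - e x y := by
    simp only [e]; split_ifs <;> simp
  have hp (u v u' v') (hu : u ∈ D) (hv : v ∉ D) (huv : adj1 u v) (hu' : u' ∈ D) (hv' : v' ∉ D)
      (huv' : adj1 u' v') (h : adj1 u u' ∨ (adj1 v u' ∧ adj1 v' u)) : p u = p u' := by
    have : P u ↔ P u' :=
      ⟨hP u v u' v' hu hv huv hu' hv' huv' (h.imp id And.left),
        hP u' v' u v hu' hv' huv' hu hv huv (h.imp adj1.symm And.right)⟩
    simp only [hp_def, this]
  have hclosed (x y z w : V d) (hxy : adj1 x y) (hyw : adj1 y w) (hxz : adj1 x z)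
      (hzw : adj1 z w) : e x y + e y w = e x z + e z w := by
    have share {u v u'} (huv : adj1 u v) (huv' : adj1 u' v) (hu : u ∈ D) (hu' : u' ∈ D)
        (hv : v ∉ D) : p u = p u' :=
      hp u v u' v hu hv huv hu' hv huv' (Or.inr ⟨huv'.symm, huv.symm⟩)
    have para {u v u' v'} (huv : adj1 u v) (huv' : adj1 u' v') (h : adj1 u u') (hu : u ∈ D)
        (hu' : u' ∈ D) (hv : v ∉ D) (hv' : v' ∉ D) : p u = p u' :=
      hp u v u' v' hu hv huv hu' hv' huv' (Or.inl h)
    have s₁ := share hxy.symm hxz.symm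
    have s₂ := share hxy hyw.symm
    have s₃ := share hxz hzw.symm
    have s₄ := share hyw hzw
    have q₁ := para hxy hzw hxz
    have q₂ := para hxy.symm hzw.symm hyw
    have q₃ := para hxz hyw hxy
    have q₄ := para hxz.symm hyw.symm hzw
    clear share para hp hP
    by_cases hx : x ∈ D <;> by_cases hy : y ∈ D <;> by_cases hz : z ∈ D <;>
      by_cases hw : w ∈ D <;> simp [hx, hy, hz, hw, e] at s₁ s₂ s₃ s₄ q₁ q₂ q₃ q₄ ⊢ <;> omega
  obtain ⟨h, hh⟩ := exists_potential (fun x i => e x (x + Pi.single i 1)) fun x i j => by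
    rw [add_right_comm x (Pi.single j 1)]
    refine hclosed x _ _ _ (adj1_add_single _ _) (adj1_add_single _ _) (adj1_add_single _ _) ?_
    rw [add_right_comm]
    exact adj1_add_single _ _
  have hdiff (x y) (hxy : adj1 x y) : h y - h x = e x y := by
    obtain ⟨i, rfl | rfl⟩ := hxy.exists_single
    · exact hh x i
    · rw [hanti, ← hh y i]; ring
  have hconst (s : Set (V d)) (hs : ∀ x ∈ s, ∀ y ∈ s, e x y = 0) (x y) (hxy : y ∈ compIn s x) :
      h y = h x := by
    induction hxy with
    | refl => rfl
    | tail _ hab ih =>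
      have := hdiff _ _ hab.2.2
      rw [hs _ hab.1 _ hab.2.1] at this
      linarith
  have h₁ := hconst D (fun x hx y hy => by simp [e, hx, hy]) u u' (hD u hu u' hu')
  have h₂ := hconst Dᶜ (fun x hx y hy => by
    rw [mem_compl_iff] at hx hy; simp [e, hx, hy]) v v' (hDc v hv v' hv')
  have h₃ := hdiff u v huv
  have h₄ := hdiff u' v' huv'
  have hpp : p u = p u' := by
    simp only [e, hu, hv, hu', hv', if_true, if_false] at h₃ h₄
    linarith
  by_contra hPu'
  simp [hp_def, hPu, hPu'] at hpp

end EdgeBoundary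

section Moats

variable {d : ℕ}

/-- Each component of the complement of a component `M` of `(Lo ∪ Hi)ᶜ` has all its boundary
vertices in `Lo`, or all in `Hi`. -/
lemma boundary_uniform (hd : 2 ≤ d) {Lo Hi : Set (V d)}
    (hsep : ∀ x ∈ Lo, ∀ y ∈ Hi, 2 < dist1 x y) {M : Set (V d)}
    (hM : IsCompOf M (Lo ∪ Hi)ᶜ) {p : V d} (hp : p ∉ M)
    {u v u' v' : V d} (hu : u ∈ compIn Mᶜ p) (hv : v ∈ M) (huv : adj1 u v)
    (hu' : u' ∈ compIn Mᶜ p) (hv' : v' ∈ M) (huv' : adj1 u' v') (hLo : u ∈ Lo) : u' ∈ Lo := by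
  obtain ⟨m, hm, rfl⟩ := hM
  have hsub : compIn (compIn (Lo ∪ Hi)ᶜ m)ᶜ p ⊆ (compIn (Lo ∪ Hi)ᶜ m)ᶜ := compIn_subset hp
  refine boundary_induction (connSet_compIn _ p)
    (connSet_compl_compIn hd (connSet_compIn _ m) ⟨m, mem_compIn_self _ _⟩ hp) (· ∈ Lo) ?_
    hu (fun h => hsub h hv) huv hu' (fun h => hsub h hv') huv' hLo
  intro u v u' v' hu hv huv hu' hv' huv' hadj hLo
  have hv'M := not_not.1 (notMem_of_adj_compIn hp hu' hv' huv')
  have hu'S : u' ∈ Lo ∪ Hi := by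
    by_contra h
    exact notMem_of_adj_compIn hm hv'M (hsub hu') huv'.symm h
  refine hu'S.resolve_right fun hHi => ?_
  have hlt := hsep u hLo u' hHi
  rcases hadj with h | h
  · rw [adj1] at h; omega
  · have := dist1_triangle u v u'
    rw [adj1] at huv h
    omega

lemma exists_moat (hd : 2 ≤ d) {Lo Hi : Set (V d)}
    (hsep : ∀ x ∈ Lo, ∀ y ∈ Hi, 2 < dist1 x y) {Λ : Set (V d)} (hΛ : ConnSet Λ)
    (hΛHi : Λ ⊆ Hi) {p : V d} (hpΛ : p ∈ Λ) {A : Set (V d)} (hA : A ⊆ Lo)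
    (hfin : (compIn Aᶜ p).Finite) :
    ∃ M ⊆ compIn Aᶜ p, IsCompOf M (Lo ∪ Hi)ᶜ ∧
      (∃ C : Set (V d), IsCompOf C Mᶜ ∧ C.Finite ∧ Λ ⊆ C) ∧
      outBnd M ⊆ Lo ∧ inBnd Λ M ⊆ Hi := by
  induction hn : (compIn Aᶜ p).ncard using Nat.strong_induction_on generalizing A with
  | _ n ih =>
  subst hn
  have hdisj (x) (hLo : x ∈ Lo) (hHi : x ∈ Hi) : False := by
    have := hsep x hLo x hHi
    simp [dist1] at this
  have hpA : p ∉ A := fun h => hdisj p (hA h) (hΛHi hpΛ)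
  set C := compIn Aᶜ p with hCdef
  -- the low region thickened by one step
  let T : Set (V d) := {x | ∃ y ∈ Lo, dist1 y x ≤ 1}
  have hLoT : Lo ⊆ T := fun x hx => ⟨x, hx, by simp [dist1]⟩
  have hTHi (x) (hx : x ∈ T) : x ∉ Hi := by
    obtain ⟨y, hy, hyx⟩ := hx
    intro hHi
    have := hsep y hy x hHi
    omega
  have hTedge (g x) (hg : g ∈ T) (hx : x ∉ T) (hgx : adj1 g x) :
      g ∈ (Lo ∪ Hi)ᶜ ∧ x ∈ (Lo ∪ Hi)ᶜ := by
    refine ⟨?_, ?_⟩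
    · rintro (h | h)
      · exact hx ⟨g, h, hgx.le⟩
      · exact hTHi g hg h
    · rintro (h | h)
      · exact hx (hLoT h)
      · obtain ⟨y, hy, hyg⟩ := hg
        have h₁ := hsep y hy x h
        have h₂ := dist1_triangle y g x
        rw [adj1] at hgx
        omega
  obtain ⟨N, hN⟩ := hfin.exists_box
  let q : V d := fun _ => |N| + 1
  -- the part of the thickened low region connected to infinity
  let G : Set (V d) := compIn (T ∪ Cᶜ) q
  have hfarG (x : V d) (hx : ∃ i, N < |x i|) : x ∈ G :=
    compIn_symm (corner_mem_compIn hd (fun y hy => Or.inr fun hyC => hN y hyC hy) hx)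
  have hqfar : ∃ i, N < |q i| := by
    refine ⟨⟨0, by omega⟩, ?_⟩
    change N < |(|N| + 1)|
    have h₁ := le_abs_self N
    have h₂ := le_abs_self (|N| + 1)
    omega
  have hqTC : q ∈ T ∪ Cᶜ := Or.inr fun h => hN q h hqfar
  have hGsub : G ⊆ T ∪ Cᶜ := compIn_subset hqTC
  have hpG : p ∉ G := fun h => (hGsub h).elim (fun h => hTHi p h (hΛHi hpΛ))
    (fun h => h (mem_compIn_self _ _))
  have hCA (x y) (hx : x ∈ C) (hy : y ∉ C) (hxy : adj1 x y) : y ∈ A :=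
    not_not.1 (notMem_of_adj_compIn (s := Aᶜ) hpA hx hy hxy)
  have hGedge (x g) (hx : x ∉ G) (hg : g ∈ G) (hxg : adj1 x g) :
      x ∈ C ∧ x ∈ (Lo ∪ Hi)ᶜ ∧ g ∈ (Lo ∪ Hi)ᶜ := by
    have hxTC := notMem_of_adj_compIn hqTC hg hx hxg.symm
    rw [mem_union, not_or, mem_compl_iff, not_not] at hxTC
    have hgT : g ∈ T := (hGsub hg).elim id fun h => hLoT (hA (hCA x g hxTC.2 h hxg))
    have := hTedge g x hgT hxTC.1 hxg.symm
    exact ⟨hxTC.2, this.2, this.1⟩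
  let D : Set (V d) := compIn Gᶜ p
  have hDG : D ⊆ Gᶜ := compIn_subset hpG
  have hDedge (u v) (hu : u ∈ D) (hv : v ∉ D) (huv : adj1 u v) : v ∈ G :=
    not_not.1 (notMem_of_adj_compIn (s := Gᶜ) hpG hu hv huv)
  have hqG : q ∈ G := mem_compIn_self _ _
  obtain ⟨u₀, v₀, hu₀, hv₀, -, -, huv₀⟩ := exists_exit (mem_compIn_univ hd p q)
    (mem_compIn_self Gᶜ p) (fun h => hDG h hqG)
  have hv₀G := hDedge u₀ v₀ hu₀ hv₀ huv₀
  obtain ⟨hu₀C, hu₀S, hv₀S⟩ := hGedge u₀ v₀ (hDG hu₀) hv₀G huv₀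
  let M : Set (V d) := compIn (Lo ∪ Hi)ᶜ u₀
  have hMS : M ⊆ (Lo ∪ Hi)ᶜ := compIn_subset hu₀S
  have hMcomp : IsCompOf M (Lo ∪ Hi)ᶜ := ⟨u₀, hu₀S, rfl⟩
  have hu₀M : u₀ ∈ M := mem_compIn_self _ _
  have hMC : M ⊆ C := by
    rw [hCdef, ← compIn_eq hu₀C]
    exact compIn_mono (compl_subset_compl.2 (hA.trans subset_union_left)) _
  have hbndM (u v) (hu : u ∈ D) (hv : v ∉ D) (huv : adj1 u v) : u ∈ M := by
    refine boundary_induction (connSet_compIn _ p)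
      (connSet_compl_compIn hd (connSet_compIn _ q) ⟨q, hqG⟩ hpG) (· ∈ M) ?_
      hu₀ hv₀ huv₀ hu hv huv hu₀M
    intro u v u' v' hu hv huv hu' hv' huv' hadj huM
    have h₁ := hGedge u v (hDG hu) (hDedge u v hu hv huv) huv
    have h₂ := hGedge u' v' (hDG hu') (hDedge u' v' hu' hv' huv') huv'
    rcases hadj with h | h
    · exact compIn_trans huM (mem_compIn_of_adj h₁.2.1 h₂.2.1 h)
    · exact compIn_trans huM (compIn_trans (mem_compIn_of_adj h₁.2.1 h₁.2.2 huv)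
        (mem_compIn_of_adj h₁.2.2 h₂.2.1 h))
  have hHiM : Hi ⊆ Mᶜ := fun x hx hxM => hMS hxM (Or.inr hx)
  have hpM : p ∉ M := hHiM (hΛHi hpΛ)
  let I : Set (V d) := compIn Mᶜ p
  have hID : I ⊆ D := by
    intro x hx
    by_contra hxD
    obtain ⟨u, v, hu, hv, huM, -, huv⟩ := exists_exit hx (mem_compIn_self Gᶜ p) hxD
    exact huM (hbndM u v hu hv huv)
  have hIfin : I.Finite := (finite_box d N).subset fun x hx hfar => hDG (hID hx) (hfarG x hfar)
  have hΛI : Λ ⊆ I := fun x hx => compIn_mono (hΛHi.trans hHiM) _ (hΛ p hpΛ x hx)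
  have hinside : inside Λ M ⊆ I :=
    iUnion₂_subset fun x hx => (compIn_eq (hΛI hx)).subset
  have hSurr : ∃ C : Set (V d), IsCompOf C Mᶜ ∧ C.Finite ∧ Λ ⊆ C :=
    ⟨I, ⟨p, hpM, rfl⟩, hIfin, hΛI⟩
  have hbndS (u v) (hu : u ∉ M) (hv : v ∈ M) (huv : adj1 u v) : u ∈ Lo ∪ Hi :=
    not_not.1 (notMem_of_adj_compIn hu₀S hv hu huv.symm)
  have hout : outBnd M ⊆ Lo := by
    rintro y ⟨⟨hyM, hyinf⟩, m, hm, hym⟩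
    obtain ⟨z, hz, hzfar⟩ : ∃ z ∈ compIn Mᶜ y, ∃ i, N < |z i| := by
      by_contra! h
      exact hyinf ((finite_box d N).subset fun z hz ⟨i, hi⟩ => absurd hi (not_lt.2 (h z hz i)))
    have hqO : q ∈ compIn Mᶜ y :=
      compIn_trans hz (corner_mem_compIn hd (fun x hx hxM => hN x (hMC hxM) hx) hzfar)
    have hOM : compIn Mᶜ y ⊆ Mᶜ := compIn_subset hyM
    have hv₀M : v₀ ∈ M := mem_compIn_of_adj hu₀S hv₀S huv₀
    obtain ⟨u, v, hu, hv, huG, -, huv⟩ := exists_exit hv₀G hqO (fun h => hOM h hv₀M)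
    have hvM : v ∈ M := not_not.1 (notMem_of_adj_compIn (s := Mᶜ) hyM hu hv huv)
    refine boundary_uniform hd hsep hMcomp hyM hu hvM huv (mem_compIn_self _ _) hm hym ?_
    refine (hbndS u v (hOM hu) hvM huv).resolve_right fun hHi => ?_
    have huC : u ∉ C := huG.resolve_left fun h => hTHi u h hHi
    exact hdisj u (hA (hCA v u (hMC hvM) huC huv.symm)) hHi
  by_cases hin : inBnd Λ M ⊆ Hi
  · exact ⟨M, hMC, hMcomp, hSurr, hout, hin⟩
  -- otherwise the inner boundary is low, and serves as a new separating set
  have hinLo : inBnd Λ M ⊆ Lo := by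
    obtain ⟨y, ⟨hyI, m, hm, hym⟩, hyHi⟩ := not_subset.1 hin
    have hIM : I ⊆ Mᶜ := compIn_subset hpM
    have hyLo := (hbndS y m (hIM (hinside hyI)) hm hym).resolve_right hyHi
    rintro y' ⟨hyI', m', hm', hym'⟩
    exact boundary_uniform hd hsep hMcomp hpM (hinside hyI) hm hym (hinside hyI') hm' hym' hyLo
  have hA' : A ∪ inBnd Λ M ⊆ Lo := union_subset hA hinLo
  have hC'C : compIn (A ∪ inBnd Λ M)ᶜ p ⊆ C :=
    compIn_mono (compl_subset_compl.2 subset_union_left) p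
  have hC'I : compIn (A ∪ inBnd Λ M)ᶜ p ⊆ I := by
    intro x hx
    by_contra hxI
    obtain ⟨u, v, hu, hv, huA, -, huv⟩ := exists_exit hx (mem_compIn_self Mᶜ p) hxI
    have hvM : v ∈ M := not_not.1 (notMem_of_adj_compIn (s := Mᶜ) hpM hu hv huv)
    exact huA (Or.inr ⟨mem_biUnion hpΛ hu, v, hvM, huv⟩)
  have hlt : (compIn (A ∪ inBnd Λ M)ᶜ p).ncard < C.ncard :=
    ncard_lt_ncard ⟨hC'C, fun h => compIn_subset (s := Mᶜ) hpM (hC'I (h hu₀C)) hu₀M⟩ hfin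
  obtain ⟨M', hM', h⟩ := ih _ hlt hA' (hfin.subset hC'C) rfl
  exact ⟨M', hM'.trans hC'C, h⟩

lemma two_lt_dist1_of_lipschitz {K : ℝ} (hK : 0 < K) {f : V d → ℝ}
    (hf : ∀ x y : V d, |f y - f x| ≤ 2 * K * dist1 x y) {a b : ℝ} (hab : 4 * K ≤ b - a)
    {x y : V d} (hx : f x < a) (hy : b ≤ f y) : 2 < dist1 x y := by
  by_contra! h
  have h₁ : (dist1 x y : ℝ) ≤ 2 := by exact_mod_cast h
  have h₂ := (le_abs_self _).trans (hf x y)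
  nlinarith

end Moats

/-- existence of moats. -/
theorem statement11 (d : ℕ) (hd : 2 ≤ d) (K : ℝ) (hK : 0 < K) (f : V d → ℝ)
    (hf : ∀ x y : V d, |f y - f x| ≤ 2 * K * dist1 x y)
    (Λ : Set (V d)) (hΛfin : Λ.Finite) (hΛne : Λ.Nonempty) (hΛconn : ConnSet Λ)
    (a b : ℝ) (hab : 4 * K ≤ b - a)
    (A C : Set (V d)) (hC : IsCompOf C Aᶜ) (hCfin : C.Finite) (hΛC : Λ ⊆ C) :
    ((∀ x ∈ A, f x < a) → (∀ x ∈ Λ, b ≤ f x) →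
      ∃ M ⊆ C, Climbing f Λ a b M) ∧
    ((∀ x ∈ A, b ≤ f x) → (∀ x ∈ Λ, f x < a) →
      ∃ M ⊆ C, Descending f Λ a b M) := by
  have hlow (x y : V d) (hx : f x < a) (hy : b ≤ f y) : 2 < dist1 x y :=
    two_lt_dist1_of_lipschitz hK hf hab hx hy
  obtain ⟨p, hp⟩ := hΛne
  obtain rfl := hC.eq_compIn (hΛC hp)
  have hlevel : {x | a ≤ f x ∧ f x < b} = ({x | f x < a} ∪ {x | b ≤ f x})ᶜ := by
    ext x; simp
  refine ⟨fun hA hΛ => ?_, fun hA hΛ => ?_⟩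
  · obtain ⟨M, hMC, hM, hsurr, hout, hin⟩ := exists_moat hd
      (Lo := {x | f x < a}) (Hi := {x | b ≤ f x}) (fun x hx y hy => hlow x y hx hy)
      hΛconn hΛ hp hA hCfin
    exact ⟨M, hMC, ⟨hlevel ▸ hM, hCfin.subset hMC, hsurr⟩, hout, hin⟩
  · obtain ⟨M, hMC, hM, hsurr, hout, hin⟩ := exists_moat hd
      (Lo := {x | b ≤ f x}) (Hi := {x | f x < a})
      (fun x hx y hy => dist1_comm y x ▸ hlow y x hy hx) hΛconn hΛ hp hA hCfin
    rw [union_comm, ← hlevel] at hM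
    exact ⟨M, hMC, ⟨hM, hCfin.subset hMC, hsurr⟩, hout, hin⟩

end
end

section
/- Let Λ ⊆ ℤ^d be finite and let F: Ω → ℝ ∪ {∞} be submodular, local with support in Λ, and translation-invariant in height. Then for all φ₁, φ₂ ∈ Ω, F(⌈(φ₁+φ₂)/2⌉) + F(⌊(φ₁+φ₂)/2⌋) ≤ F(φ₁) + F(φ₂). -/
noncomputable section

/-- Midpoint inequality for an ordered pair of height functions at bounded distance, by
successively reflecting the largest value of the gap `ψ - φ`. -/
theorem midpoint_le_of_gap_le {ι : Type*} (F : (ι → ℤ) → WithTop ℝ)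
    (hsub : ∀ φ ψ : ι → ℤ, F (φ ⊓ ψ) + F (φ ⊔ ψ) ≤ F φ + F ψ)
    (hinv : ∀ (φ : ι → ℤ) (a : ℤ), F (fun x => φ x + a) = F φ) (n : ℕ) :
    ∀ φ ψ : ι → ℤ, (∀ x, φ x ≤ ψ x) → (∀ x, ψ x ≤ φ x + (n + 1)) →
      F (fun x => (φ x + ψ x + 1) / 2) + F (fun x => (φ x + ψ x) / 2) ≤ F φ + F ψ := by
  induction n with
  | zero =>
    intro φ ψ h₀ h₁
    have hceil : (fun x => (φ x + ψ x + 1) / 2) = ψ := by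
      funext x
      have := h₀ x
      have := h₁ x
      omega
    have hfloor : (fun x => (φ x + ψ x) / 2) = φ := by
      funext x
      have := h₀ x
      have := h₁ x
      omega
    rw [hceil, hfloor, add_comm]
  | succ n ih =>
    intro φ ψ h₀ h₁
    set φ' : ι → ℤ := fun x => max (φ x) (ψ x - (n + 1)) with hφ'
    set ψ' : ι → ℤ := fun x => min (φ x + (n + 1)) (ψ x) with hψ'
    have hsum : ∀ x, φ' x + ψ' x = φ x + ψ x := by
      intro x
      simp only [hφ', hψ']
      omega
    have hmid := ih φ' ψ'
      (by intro x; have := h₀ x; have := h₁ x; simp only [hφ', hψ']; push_cast at *; omega)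
      (by intro x; have := h₀ x; have := h₁ x; simp only [hφ', hψ']; push_cast at *; omega)
    simp only [hsum] at hmid
    have hreflect := hsub φ (fun x => ψ x + -(n + 1 : ℤ))
    have hinf : φ ⊓ (fun x => ψ x + -(n + 1 : ℤ)) = fun x => ψ' x + -(n + 1 : ℤ) := by
      funext x
      simp only [Pi.inf_apply, hψ']
      omega
    have hsup : φ ⊔ (fun x => ψ x + -(n + 1 : ℤ)) = φ' := by
      funext x
      simp only [Pi.sup_apply, hφ']
      omega
    rw [hinf, hsup, hinv, hinv, add_comm (F ψ')] at hreflect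
    exact hmid.trans hreflect

/-- submodular midpoint inequality.  If `F : Ω → ℝ ∪ {∞}` is
submodular, local with support in a finite `Λ`, and invariant under adding integer
constants, then `F(⌈(φ₁+φ₂)/2⌉) + F(⌊(φ₁+φ₂)/2⌋) ≤ F(φ₁) + F(φ₂)`. -/
theorem statement16 (d : ℕ) (hd : 1 ≤ d) (Λ : Finset (V d))
    (F : (V d → ℤ) → WithTop ℝ)
    (hsub : ∀ φ ψ : V d → ℤ, F (φ ⊓ ψ) + F (φ ⊔ ψ) ≤ F φ + F ψ)
    (hloc : ∀ φ ψ : V d → ℤ, (∀ x ∈ Λ, φ x = ψ x) → F φ = F ψ)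
    (hinv : ∀ (φ : V d → ℤ) (a : ℤ), F (fun x => φ x + a) = F φ) :
    ∀ φ₁ φ₂ : V d → ℤ,
      F (fun x => Int.fdiv (φ₁ x + φ₂ x + 1) 2) + F (fun x => Int.fdiv (φ₁ x + φ₂ x) 2) ≤
        F φ₁ + F φ₂ := by
  intro φ₁ φ₂
  set ψ : V d → ℤ := fun x => if x ∈ Λ then φ₂ x else φ₁ x with hψ
  have hψΛ : ∀ x ∈ Λ, φ₂ x = ψ x := fun x hx => by simp [hψ, hx]
  set n : ℕ := ∑ x ∈ Λ, (φ₂ x - φ₁ x).natAbs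
  have hgap : ∀ x, (ψ x - φ₁ x).natAbs ≤ n := by
    intro x
    by_cases hx : x ∈ Λ
    · rw [← hψΛ x hx]
      exact Finset.single_le_sum (f := fun x => (φ₂ x - φ₁ x).natAbs)
        (fun _ _ => Nat.zero_le _) hx
    · simp [hψ, hx]
  have hmid := midpoint_le_of_gap_le F hsub hinv n (φ₁ ⊓ ψ) (φ₁ ⊔ ψ)
    (fun _ => inf_le_sup)
    (by intro x; have := hgap x; simp only [Pi.inf_apply, Pi.sup_apply]; omega)
  have hsum : ∀ x, (φ₁ ⊓ ψ) x + (φ₁ ⊔ ψ) x = φ₁ x + ψ x :=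
    fun x => min_add_max (φ₁ x) (ψ x)
  simp only [hsum] at hmid
  simp only [Int.fdiv_eq_ediv_of_nonneg _ (zero_le_two : (0 : ℤ) ≤ 2)]
  rw [hloc φ₂ ψ hψΛ,
    hloc (fun x => (φ₁ x + φ₂ x + 1) / 2) (fun x => (φ₁ x + ψ x + 1) / 2)
      (fun x hx => by simp only [hψΛ x hx]),
    hloc (fun x => (φ₁ x + φ₂ x) / 2) (fun x => (φ₁ x + ψ x) / 2)
      (fun x hx => by simp only [hψΛ x hx])]
  exact hmid.trans (hsub φ₁ ψ)

end
end
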